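/- Let μ_sc be the standard semicircular distribution on [−2, 2] and θ ∈ ℝ. Then the monotone convolution δ_θ ▷ μ_sc equals the measure with density √(4−x²) / (2π(θ²+1−θx)) on |x| ≤ 2, plus, if |θ| > 1, an atom of mass 1 − 1/θ² at the point θ + 1/θ. -/

import Mathlib

open MeasureTheory Real

/-- The Cauchy transform `G_μ(z) = ∫ (z − x)⁻¹ dμ(x)`. -/
noncomputable def cauchyTransform (μ : Measure ℝ) (z : ℂ) : ℂ :=
  ∫ x, (z - (x : ℂ))⁻¹ ∂μ

/-- The reciprocal Cauchy transform `F_μ = 1/G_μ`. -/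
noncomputable def recipCauchy (μ : Measure ℝ) (z : ℂ) : ℂ :=
  (cauchyTransform μ z)⁻¹

/-- The standard semicircular distribution, with density `√(4 − x²)/(2π)` on `[−2, 2]`. -/
noncomputable def semicircle : Measure ℝ :=
  volume.withDensity fun x =>
    ENNReal.ofReal (if |x| ≤ 2 then Real.sqrt (4 - x ^ 2) / (2 * π) else 0)

section

open Filter Topology Set Complex

/-- The resolvent kernel is integrable against a finite measure in the upper half-plane. -/
lemma integrable_inv_sub_ofReal (μ : Measure ℝ) [IsFiniteMeasure μ] {z : ℂ} (hz : 0 < z.im) :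
    Integrable (fun x : ℝ => (z - (x : ℂ))⁻¹) μ := by
  refine Integrable.of_bound (C := z.im⁻¹) (by fun_prop) (Eventually.of_forall fun x => ?_)
  rw [norm_inv]
  have h := Complex.abs_im_le_norm (z - x)
  rw [Complex.sub_im, Complex.ofReal_im, sub_zero, abs_of_pos hz] at h
  exact inv_anti₀ hz h

lemma im_cauchyTransform (μ : Measure ℝ) [IsFiniteMeasure μ] {x y : ℝ} (hy : 0 < y) :
    (cauchyTransform μ (x + y * I)).im = -∫ t, y * ((x - t) ^ 2 + y ^ 2)⁻¹ ∂μ := by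
  have hz : 0 < ((x : ℂ) + y * I).im := by simpa using hy
  have h := Complex.imCLM.integral_comp_comm (integrable_inv_sub_ofReal μ hz)
  rw [Complex.imCLM_apply] at h
  rw [cauchyTransform, ← h, ← integral_neg]
  congr 1 with t
  simp [Complex.inv_im, Complex.normSq_apply, div_eq_mul_inv, pow_two]

lemma integrable_prod_poissonKernel (μ : Measure ℝ) [IsFiniteMeasure μ] {y : ℝ} (hy : 0 < y) :
    Integrable (fun p : ℝ × ℝ => y * ((p.2 - p.1) ^ 2 + y ^ 2)⁻¹) (μ.prod volume) := by
  have hk : Integrable (fun x : ℝ => y * (x ^ 2 + y ^ 2)⁻¹) := by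
    refine ((integrable_inv_one_add_sq.comp_mul_left' (inv_ne_zero hy.ne')).const_mul
      y⁻¹).congr (Eventually.of_forall fun x => ?_)
    simp only
    field_simp
    ring
  rw [integrable_prod_iff (by fun_prop)]
  refine ⟨Eventually.of_forall fun t => hk.comp_sub_right t, ?_⟩
  have h (t : ℝ) : ∫ x : ℝ, ‖y * ((x - t) ^ 2 + y ^ 2)⁻¹‖ = ∫ x : ℝ, ‖y * (x ^ 2 + y ^ 2)⁻¹‖ :=
    integral_sub_right_eq_self (fun x : ℝ => ‖y * (x ^ 2 + y ^ 2)⁻¹‖) t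
  simp only [h]
  exact integrable_const _

lemma integrable_prod_bounded_mul_inv_one_add_sq (μ : Measure ℝ) [IsFiniteMeasure μ]
    (f : BoundedContinuousFunction ℝ ℝ) (y : ℝ) :
    Integrable (fun p : ℝ × ℝ => f (p.1 + y * p.2) * (1 + p.2 ^ 2)⁻¹) (μ.prod volume) := by
  have h : Integrable (fun p : ℝ × ℝ => (1 : ℝ) * (1 + p.2 ^ 2)⁻¹) (μ.prod volume) :=
    Integrable.mul_prod (integrable_const 1) integrable_inv_one_add_sq
  simp only [one_mul] at h
  exact h.bdd_mul (c := ‖f‖) (by fun_prop) (Eventually.of_forall fun p => f.norm_coe_le_norm _)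

/-- Smearing a test function by the Cauchy kernel, expressed by the Cauchy transform. -/
lemma integral_prod_mul_inv_one_add_sq (μ : Measure ℝ) [IsFiniteMeasure μ]
    (f : BoundedContinuousFunction ℝ ℝ) {y : ℝ} (hy : 0 < y) :
    ∫ p : ℝ × ℝ, f (p.1 + y * p.2) * (1 + p.2 ^ 2)⁻¹ ∂(μ.prod volume) =
      ∫ x : ℝ, f x * -(cauchyTransform μ (x + y * I)).im := by
  rw [integral_prod _ (integrable_prod_bounded_mul_inv_one_add_sq μ f y)]
  have h (t : ℝ) : ∫ u : ℝ, f (t + y * u) * (1 + u ^ 2)⁻¹ =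
      ∫ x : ℝ, f x * (y * ((x - t) ^ 2 + y ^ 2)⁻¹) := by
    have h₁ := Measure.integral_comp_mul_left
      (fun v : ℝ => f (t + v) * (y * ((t + v - t) ^ 2 + y ^ 2)⁻¹)) y
    rw [integral_add_left_eq_self (fun x : ℝ => f x * (y * ((x - t) ^ 2 + y ^ 2)⁻¹)) t,
      abs_of_pos (inv_pos.2 hy), smul_eq_mul, inv_mul_eq_div, eq_div_iff hy.ne', mul_comm,
      ← integral_const_mul] at h₁
    rw [← h₁]
    congr 1 with u
    have : (t + y * u - t) ^ 2 + y ^ 2 = y ^ 2 * (1 + u ^ 2) := by ring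
    rw [this]
    field_simp
  simp only [h]
  rw [integral_integral_swap]
  · congr 1 with x
    rw [im_cauchyTransform μ hy, neg_neg, integral_const_mul]
  · exact (integrable_prod_poissonKernel μ hy).bdd_mul (f := fun p : ℝ × ℝ => f p.2) (c := ‖f‖)
      (by fun_prop) (Eventually.of_forall fun p => f.norm_coe_le_norm _)

lemma tendsto_integral_prod_mul_inv_one_add_sq (μ : Measure ℝ) [IsFiniteMeasure μ]
    (f : BoundedContinuousFunction ℝ ℝ) :
    Tendsto (fun y : ℝ => ∫ p : ℝ × ℝ, f (p.1 + y * p.2) * (1 + p.2 ^ 2)⁻¹ ∂(μ.prod volume))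
      (𝓝[>] 0) (𝓝 ((∫ x, f x ∂μ) * π)) := by
  rw [← integral_univ_inv_one_add_sq, ← integral_prod_mul]
  have hb : Integrable (fun p : ℝ × ℝ => ‖f‖ * (1 + p.2 ^ 2)⁻¹) (μ.prod volume) :=
    Integrable.mul_prod (integrable_const _) integrable_inv_one_add_sq
  refine tendsto_integral_filter_of_dominated_convergence _
    (Eventually.of_forall fun y => by fun_prop)
    (Eventually.of_forall fun y => Eventually.of_forall fun p => ?_) hb
    (Eventually.of_forall fun p => ?_)
  · have : 0 ≤ (1 + p.2 ^ 2)⁻¹ := by positivity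
    rw [norm_mul, Real.norm_of_nonneg this]
    gcongr
    exact f.norm_coe_le_norm _
  · have : Continuous fun y : ℝ => f (p.1 + y * p.2) * (1 + p.2 ^ 2)⁻¹ := by fun_prop
    simpa using (this.tendsto 0).mono_left nhdsWithin_le_nhds

/-- A finite measure on `ℝ` is determined by its Cauchy transform on the upper half-plane. -/
lemma eq_of_cauchyTransform_eq {μ ν : Measure ℝ} [IsFiniteMeasure μ] [IsFiniteMeasure ν]
    (h : ∀ z : ℂ, 0 < z.im → cauchyTransform μ z = cauchyTransform ν z) : μ = ν := by
  refine ext_of_forall_integral_eq_of_IsFiniteMeasure fun f => ?_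
  refine mul_right_cancel₀ Real.pi_ne_zero (tendsto_nhds_unique_of_eventuallyEq
    (tendsto_integral_prod_mul_inv_one_add_sq μ f)
    (tendsto_integral_prod_mul_inv_one_add_sq ν f) ?_)
  filter_upwards [self_mem_nhdsWithin] with y (hy : 0 < y)
  rw [integral_prod_mul_inv_one_add_sq μ f hy, integral_prod_mul_inv_one_add_sq ν f hy]
  congr 1 with x
  rw [h _ (by simpa using hy)]

/-- The generating series `∑ wⁿ sin((n+1)φ) = sin φ / (1 - 2 w cos φ + w²)`. -/
lemma hasSum_pow_mul_sin {w : ℂ} (hw : ‖w‖ < 1) (φ : ℝ) :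
    HasSum (fun n : ℕ => w ^ n * (Real.sin ((n + 1) * φ) : ℂ))
      (Real.sin φ * (1 - 2 * w * Real.cos φ + w ^ 2)⁻¹) := by
  have hnorm (s : ℝ) : ‖w * exp (s * I)‖ < 1 := by
    rwa [norm_mul, norm_exp_ofReal_mul_I, mul_one]
  have hne (s : ℝ) : 1 - w * exp (s * I) ≠ 0 := fun h => by
    have := hnorm s
    rw [← sub_eq_zero.1 h, norm_one] at this
    exact lt_irrefl _ this
  have hsum := (((hasSum_geometric_of_norm_lt_one (hnorm (-φ))).mul_right (exp ((-φ : ℝ) * I))).sub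
    ((hasSum_geometric_of_norm_lt_one (hnorm φ)).mul_right (exp (φ * I)))).mul_right (I / 2)
  have h₁ := hne φ
  have h₂ := hne (-φ)
  have hee : exp ((-φ : ℝ) * I) * exp (φ * I) = 1 := by
    rw [← Complex.exp_add]; simp
  convert! hsum using 1
  · ext n
    rw [ofReal_sin, Complex.sin, mul_pow, mul_pow, ← Complex.exp_nat_mul, ← Complex.exp_nat_mul,
      mul_assoc, mul_assoc, ← Complex.exp_add, ← Complex.exp_add]
    push_cast
    ring_nf
  · have hs : (Real.sin φ : ℂ) = (exp ((-φ : ℝ) * I) - exp (φ * I)) * I / 2 := by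
      rw [ofReal_sin, Complex.sin]; push_cast; rfl
    have hc : (Real.cos φ : ℂ) = (exp (φ * I) + exp ((-φ : ℝ) * I)) / 2 := by
      rw [ofReal_cos, Complex.cos]; push_cast; rfl
    have hprod : 1 - 2 * w * Real.cos φ + w ^ 2 =
        (1 - w * exp (φ * I)) * (1 - w * exp ((-φ : ℝ) * I)) := by
      rw [hc]; linear_combination (-w ^ 2) * hee
    rw [hprod, hs]
    generalize exp (φ * I) = a at *
    generalize exp ((-φ : ℝ) * I) = b at *
    generalize hp : 1 - w * a = p at *
    generalize hq : 1 - w * b = q at *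
    field_simp
    rw [← hp, ← hq]
    ring

lemma integral_sin_natCast_succ_mul_mul_sin (n : ℕ) :
    ∫ φ in (0 : ℝ)..π, Real.sin ((n + 1) * φ) * Real.sin φ = if n = 0 then π / 2 else 0 := by
  split_ifs with hn
  · subst hn
    simp [← pow_two, integral_sin_sq]
  · have hn' : (n : ℝ) ≠ 0 := Nat.cast_ne_zero.2 hn
    have hn₂ : (n : ℝ) + 2 ≠ 0 := by positivity
    have h (φ : ℝ) : Real.sin ((n + 1) * φ) * Real.sin φ =
        (Real.cos (n * φ) - Real.cos ((n + 2) * φ)) / 2 := by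
      rw [show (n : ℝ) * φ = (n + 1) * φ - φ by ring,
        show ((n : ℝ) + 2) * φ = (n + 1) * φ + φ by ring, Real.cos_sub, Real.cos_add]
      ring
    have hs : Real.sin ((n + 2) * π) = 0 := by
      simpa using Real.sin_nat_mul_pi (n + 2)
    simp only [h]
    rw [intervalIntegral.integral_div, intervalIntegral.integral_sub
      (by apply Continuous.intervalIntegrable; fun_prop)
      (by apply Continuous.intervalIntegrable; fun_prop),
      intervalIntegral.integral_comp_mul_left _ hn', intervalIntegral.integral_comp_mul_left _ hn₂]
    simp [integral_cos, hs]

lemma integral_sin_sq_mul_inv_of_norm_lt_one {w : ℂ} (hw : ‖w‖ < 1) :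
    ∫ φ in (0 : ℝ)..π, (Real.sin φ : ℂ) ^ 2 * (1 - 2 * w * Real.cos φ + w ^ 2)⁻¹ =
      (π : ℂ) / 2 := by
  have hint := intervalIntegral.hasSum_integral_of_dominated_convergence
    (μ := volume) (a := 0) (b := π)
    (F := fun (n : ℕ) (φ : ℝ) => w ^ n * (Real.sin ((n + 1) * φ) * Real.sin φ : ℝ))
    (f := fun φ => (Real.sin φ : ℂ) ^ 2 * (1 - 2 * w * Real.cos φ + w ^ 2)⁻¹)
    (fun n _ => ‖w‖ ^ n) (fun n => by fun_prop) ?_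
    (Eventually.of_forall fun _ _ => summable_geometric_of_lt_one (norm_nonneg _) hw)
    (by simp) ?_
  · simp only [intervalIntegral.integral_const_mul, intervalIntegral.integral_ofReal,
      integral_sin_natCast_succ_mul_mul_sin] at hint
    have h := hint.unique (hasSum_single 0 fun n hn => by simp [hn])
    rw [h]
    simp
  · refine fun n => Eventually.of_forall fun φ _ => ?_
    rw [norm_mul, norm_pow, Complex.norm_real, norm_mul, Real.norm_eq_abs, Real.norm_eq_abs]
    exact mul_le_of_le_one_right (by positivity)
      (mul_le_one₀ (Real.abs_sin_le_one _) (abs_nonneg _) (Real.abs_sin_le_one _))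
  · refine Eventually.of_forall fun φ _ => ?_
    convert! (hasSum_pow_mul_sin hw φ).mul_right (Real.sin φ : ℂ) using 1
    · ext n; push_cast; ring
    · ring

lemma integral_sin_sq_mul_inv_of_sq_eq_one {w : ℝ} (hw : w ^ 2 = 1) :
    ∫ φ in (0 : ℝ)..π, (Real.sin φ : ℂ) ^ 2 * (1 - 2 * (w : ℂ) * Real.cos φ + (w : ℂ) ^ 2)⁻¹ =
      (π : ℂ) / 2 := by
  have h : ∀ φ ∈ Ioo 0 π,
      (Real.sin φ : ℂ) ^ 2 * (1 - 2 * (w : ℂ) * Real.cos φ + (w : ℂ) ^ 2)⁻¹ =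
        ((1 + w * Real.cos φ) / 2 : ℝ) := fun φ hφ => by
    have hs := Real.sin_pos_of_mem_Ioo hφ
    have hsc := Real.sin_sq_add_cos_sq φ
    have hprod : Real.sin φ ^ 2 = (1 + w * Real.cos φ) * (1 - w * Real.cos φ) := by
      linear_combination hsc + Real.cos φ ^ 2 * hw
    have hne : 1 - w * Real.cos φ ≠ 0 := fun h0 => by
      rw [h0, mul_zero] at hprod
      exact hs.ne' (pow_eq_zero_iff two_ne_zero |>.1 hprod)
    have hden : (1 : ℂ) - 2 * w * Real.cos φ + (w : ℂ) ^ 2 =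
        ((2 * (1 - w * Real.cos φ) : ℝ) : ℂ) := by
      rw [← ofReal_pow, hw]; push_cast; ring
    rw [hden, ← ofReal_pow, ← ofReal_inv, ← ofReal_mul, hprod]
    congr 1
    field_simp
  rw [intervalIntegral.integral_of_le Real.pi_pos.le, integral_Ioc_eq_integral_Ioo,
    setIntegral_congr_fun measurableSet_Ioo h, ← integral_Ioc_eq_integral_Ioo,
    ← intervalIntegral.integral_of_le Real.pi_pos.le, intervalIntegral.integral_ofReal]
  rw [intervalIntegral.integral_div, intervalIntegral.integral_add
      (by simp) (by apply Continuous.intervalIntegrable; fun_prop)]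
  simp [integral_cos]

lemma measurable_semicircle_density :
    Measurable fun x : ℝ => if |x| ≤ 2 then Real.sqrt (4 - x ^ 2) / (2 * π) else 0 :=
  Measurable.ite (measurableSet_le (by fun_prop) (by fun_prop)) (by fun_prop) (by fun_prop)

/-- Integration against the semicircle law in the coordinate `x = 2 cos φ`. -/
lemma integral_semicircle (g : ℝ → ℂ) :
    ∫ x, g x ∂semicircle =
      2 / π * ∫ φ in (0 : ℝ)..π, (Real.sin φ : ℂ) ^ 2 * g (2 * Real.cos φ) := by
  have hder (φ : ℝ) (_ : φ ∈ Icc 0 π) :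
      HasDerivWithinAt (fun φ => 2 * Real.cos φ) (2 * -Real.sin φ) (Icc 0 π) φ :=
    ((Real.hasDerivAt_cos φ).const_mul 2).hasDerivWithinAt
  have hinj : InjOn (fun φ => 2 * Real.cos φ) (Icc 0 π) := fun a ha b hb hab =>
    Real.injOn_cos ha hb (mul_left_cancel₀ two_ne_zero hab)
  have hmeas := measurable_semicircle_density
  rw [semicircle, integral_withDensity_eq_integral_toReal_smul (by fun_prop)
    (Eventually.of_forall fun _ => ENNReal.ofReal_lt_top),
    ← setIntegral_eq_integral_of_forall_compl_eq_zero (s := (fun φ => 2 * Real.cos φ) '' Icc 0 π),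
    integral_image_eq_integral_abs_deriv_smul measurableSet_Icc hder hinj,
    intervalIntegral.integral_of_le Real.pi_pos.le, ← integral_Icc_eq_integral_Ioc,
    ← integral_const_mul]
  · refine setIntegral_congr_fun measurableSet_Icc fun φ hφ => ?_
    have hs := Real.sin_nonneg_of_mem_Icc hφ
    have hsqrt : Real.sqrt (4 - (2 * Real.cos φ) ^ 2) = 2 * Real.sin φ := by
      rw [show 4 - (2 * Real.cos φ) ^ 2 = (2 * Real.sin φ) ^ 2 by
        linear_combination (-4) * Real.sin_sq_add_cos_sq φ]
      exact Real.sqrt_sq (by positivity)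
    have habs : |2 * Real.cos φ| ≤ 2 := by
      rw [abs_mul, abs_two]
      linarith [Real.abs_cos_le_one φ]
    have hpi := Real.pi_pos
    have hπ : (π : ℂ) ≠ 0 := ofReal_ne_zero.2 hpi.ne'
    simp only [habs, if_true, hsqrt]
    rw [ENNReal.toReal_ofReal (by positivity), mul_neg, abs_neg, abs_of_nonneg (by positivity),
      real_smul, real_smul]
    push_cast
    field_simp
  · intro x hx
    have : ¬ |x| ≤ 2 := fun hx2 => hx ⟨Real.arccos (x / 2), ⟨Real.arccos_nonneg _,
      Real.arccos_le_pi _⟩, by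
        have := abs_le.1 hx2
        simp only
        rw [Real.cos_arccos (by linarith) (by linarith)]
        ring⟩
    simp [this]

/-- The Poisson-type integral `∫ (1 - w x + w²)⁻¹ dμ_sc(x) = 1`. -/
lemma integral_semicircle_inv {w : ℂ} (hw : ‖w‖ < 1 ∨ ∃ r : ℝ, r ^ 2 = 1 ∧ (r : ℂ) = w) :
    ∫ x, (1 - w * x + w ^ 2)⁻¹ ∂semicircle = 1 := by
  have h : ∫ φ in (0 : ℝ)..π, (Real.sin φ : ℂ) ^ 2 * (1 - 2 * w * Real.cos φ + w ^ 2)⁻¹ =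
      (π : ℂ) / 2 := by
    obtain hw | ⟨r, hr, rfl⟩ := hw
    · exact integral_sin_sq_mul_inv_of_norm_lt_one hw
    · exact integral_sin_sq_mul_inv_of_sq_eq_one hr
  have hπ : (π : ℂ) ≠ 0 := ofReal_ne_zero.2 Real.pi_ne_zero
  rw [integral_semicircle]
  have hx (φ : ℝ) : 1 - w * ((2 * Real.cos φ : ℝ) : ℂ) + w ^ 2 =
      1 - 2 * w * Real.cos φ + w ^ 2 := by
    push_cast; ring
  simp only [hx, h]
  field_simp

instance : IsFiniteMeasure semicircle := by
  have h := integral_semicircle_inv (w := 0) (by simp)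
  have hi : Integrable (fun _ : ℝ => (1 : ℂ)) semicircle :=
    .of_integral_ne_zero fun h₀ => one_ne_zero (h.symm.trans (by simpa using h₀))
  simpa [integrable_const_iff] using hi

lemma exists_add_inv_eq {z : ℂ} (hz : 0 < z.im) : ∃ w : ℂ, w ≠ 0 ∧ ‖w‖ < 1 ∧ w + w⁻¹ = z := by
  obtain ⟨s, hs⟩ := IsAlgClosed.exists_pow_nat_eq (z ^ 2 - 4) (n := 2) two_pos
  have hmul : ((z + s) / 2) * ((z - s) / 2) = 1 := by linear_combination (-1 / 4) * hs
  have key (a b : ℂ) (hab : a * b = 1) (hsum : a + b = z) (hle : ‖a‖ ≤ ‖b‖) :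
      ∃ w : ℂ, w ≠ 0 ∧ ‖w‖ < 1 ∧ w + w⁻¹ = z := by
    have hn : ‖a‖ * ‖b‖ = 1 := by rw [← norm_mul, hab, norm_one]
    refine ⟨a, left_ne_zero_of_mul_eq_one hab, ?_, by rw [inv_eq_of_mul_eq_one_right hab, hsum]⟩
    by_contra! h1
    have ha : ‖a‖ = 1 := by nlinarith
    have hb : b = (starRingEnd ℂ) a := by
      rw [← inv_eq_of_mul_eq_one_right hab, Complex.inv_def, normSq_eq_norm_sq, ha]
      simp
    rw [← hsum, hb, add_im, conj_im] at hz
    simp at hz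
  obtain h | h := le_total ‖(z + s) / 2‖ ‖(z - s) / 2‖
  · exact key _ _ hmul (by ring) h
  · exact key _ _ (by rw [mul_comm, hmul]) (by ring) h

/-- The quadratic equation satisfied by the Cauchy transform of the semicircle law. -/
lemma cauchyTransform_semicircle_add_inv {w : ℂ} (hw₀ : w ≠ 0) (hw : ‖w‖ < 1) :
    cauchyTransform semicircle (w + w⁻¹) = w := by
  have h (x : ℝ) : (w + w⁻¹ - x)⁻¹ = w * (1 - w * x + w ^ 2)⁻¹ := by
    rw [← inv_inv (w * _), mul_inv, inv_inv]
    congr 1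
    field_simp
    ring
  simp only [cauchyTransform, h]
  rw [integral_const_mul, integral_semicircle_inv (.inl hw), mul_one]

lemma integral_semicircle_inv_theta (θ : ℝ) :
    ∫ x : ℝ, ((θ : ℂ) ^ 2 + 1 - θ * x)⁻¹ ∂semicircle =
      if 1 < |θ| then ((θ : ℂ) ^ 2)⁻¹ else 1 := by
  split_ifs with hθ
  · have hθ₀ : (θ : ℂ) ≠ 0 := by
      rintro h
      simp [ofReal_eq_zero.1 h] at hθ
      linarith
    have h (x : ℝ) : ((θ : ℂ) ^ 2 + 1 - θ * x)⁻¹ =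
        ((θ : ℂ) ^ 2)⁻¹ * (1 - (θ : ℂ)⁻¹ * x + (θ : ℂ)⁻¹ ^ 2)⁻¹ := by
      rw [← mul_inv]
      congr 1
      field_simp
      ring
    simp only [h]
    rw [integral_const_mul, integral_semicircle_inv, mul_one]
    left
    rw [norm_inv, norm_real, Real.norm_eq_abs]
    exact inv_lt_one_of_one_lt₀ hθ
  · have h (x : ℝ) : ((θ : ℂ) ^ 2 + 1 - θ * x)⁻¹ = (1 - (θ : ℂ) * x + (θ : ℂ) ^ 2)⁻¹ := by
      congr 1; ring
    simp only [h]
    refine integral_semicircle_inv ?_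
    obtain h | h := (not_lt.1 hθ).lt_or_eq
    · exact .inl (by rwa [norm_real, Real.norm_eq_abs])
    · exact .inr ⟨θ, by rw [← sq_abs, h, one_pow], rfl⟩

lemma theta_sq_add_one_sub_nonneg (θ : ℝ) {x : ℝ} (hx : |x| ≤ 2) : 0 ≤ θ ^ 2 + 1 - θ * x := by
  have h : θ * x ≤ |θ| * 2 := (le_abs_self _).trans
    ((abs_mul θ x).trans_le (mul_le_mul_of_nonneg_left hx (abs_nonneg θ)))
  nlinarith [sq_nonneg (|θ| - 1), sq_abs θ]

lemma ae_semicircle_abs_le : ∀ᵐ x ∂semicircle, |x| ≤ 2 := by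
  have hmeas := measurable_semicircle_density
  rw [semicircle, ae_withDensity_iff (by fun_prop)]
  refine Eventually.of_forall fun x hx => ?_
  by_contra h
  simp [h] at hx

lemma withDensity_eq_semicircle_withDensity (θ : ℝ) :
    (volume.withDensity fun x => ENNReal.ofReal (if |x| ≤ 2 then
      Real.sqrt (4 - x ^ 2) / (2 * π * (θ ^ 2 + 1 - θ * x)) else 0)) =
      semicircle.withDensity fun x => ENNReal.ofReal (θ ^ 2 + 1 - θ * x)⁻¹ := by
  have hmeas := measurable_semicircle_density
  rw [semicircle, ← withDensity_mul _ (by fun_prop) (by fun_prop)]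
  congr 1 with x
  have hpi := Real.pi_pos
  rw [Pi.mul_apply, ← ENNReal.ofReal_mul (by split_ifs <;> positivity)]
  congr 1
  split_ifs
  · rw [← div_div, div_eq_mul_inv (_ / _)]
  · rw [zero_mul]

lemma integrable_semicircle_inv_theta (θ : ℝ) :
    Integrable (fun x : ℝ => ((θ : ℂ) ^ 2 + 1 - θ * x)⁻¹) semicircle := by
  refine .of_integral_ne_zero ?_
  rw [integral_semicircle_inv_theta]
  split_ifs with h
  · have hθ : θ ≠ 0 := by rintro rfl; simp at h; linarith
    simpa using hθ
  · exact one_ne_zero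

instance isFiniteMeasure_semicircle_withDensity (θ : ℝ) :
    IsFiniteMeasure (semicircle.withDensity fun x => ENNReal.ofReal (θ ^ 2 + 1 - θ * x)⁻¹) := by
  refine isFiniteMeasure_withDensity_ofReal (Integrable.hasFiniteIntegral ?_)
  convert (integrable_semicircle_inv_theta θ).re with x
  rw [RCLike.re_eq_complex_re, ← ofReal_re (θ ^ 2 + 1 - θ * x)⁻¹]
  push_cast
  rfl


lemma theta_mul_sub_ne_zero (θ : ℝ) {z : ℂ} (hz : 0 < z.im) :
    (θ : ℂ) * z - (θ ^ 2 + 1) ≠ 0 := fun h => by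
  have him := congrArg im h
  rw [← ofReal_pow, ← ofReal_one, ← ofReal_add, sub_im, im_ofReal_mul, ofReal_im, sub_zero,
    zero_im] at him
  have hθ : θ = 0 := (mul_eq_zero.1 him).resolve_right hz.ne'
  simp [hθ] at h

/-- The Cauchy transform of the absolutely continuous part, by partial fractions. -/
lemma cauchyTransform_semicircle_withDensity (θ : ℝ) {z : ℂ} (hz : 0 < z.im) :
    cauchyTransform (semicircle.withDensity fun x => ENNReal.ofReal (θ ^ 2 + 1 - θ * x)⁻¹) z =
      (θ * (if 1 < |θ| then ((θ : ℂ) ^ 2)⁻¹ else 1) - cauchyTransform semicircle z) /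
        (θ * z - (θ ^ 2 + 1)) := by
  have hD := theta_mul_sub_ne_zero θ hz
  have hP := integrable_semicircle_inv_theta θ
  have hP_ne : ∀ᵐ x ∂semicircle, θ ^ 2 + 1 - θ * x ≠ 0 := by
    refine (withDensity_absolutelyContinuous volume _).ae_le ?_
    filter_upwards [(countable_singleton ((θ ^ 2 + 1) / θ)).ae_notMem volume] with x hx h
    have hθ : θ ≠ 0 := by
      rintro rfl
      simp at h
    exact hx (by rw [mem_singleton_iff, eq_div_iff hθ]; linarith)
  rw [cauchyTransform, integral_withDensity_eq_integral_toReal_smul (by fun_prop)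
    (Eventually.of_forall fun _ => ENNReal.ofReal_lt_top), ← integral_semicircle_inv_theta,
    cauchyTransform, ← integral_const_mul,
    ← integral_sub (hP.const_mul _) (integrable_inv_sub_ofReal _ hz), ← integral_div]
  refine integral_congr_ae ?_
  filter_upwards [ae_semicircle_abs_le, hP_ne] with x hx hx₀
  have hQ : z - x ≠ 0 := fun h => by
    have := congrArg im h
    simp at this
    exact hz.ne' this
  have hP₀ : (θ : ℂ) ^ 2 + 1 - θ * x ≠ 0 := by exact_mod_cast hx₀
  rw [ENNReal.toReal_ofReal (inv_nonneg.2 (theta_sq_add_one_sub_nonneg θ hx)), real_smul]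
  push_cast
  field_simp
  ring

lemma one_sub_one_div_sq_nonneg {θ : ℝ} (hθ : 1 < |θ|) : 0 ≤ 1 - 1 / θ ^ 2 := by
  have : 1 < θ ^ 2 := by rw [← sq_abs]; exact one_lt_pow₀ hθ two_ne_zero
  rw [sub_nonneg, div_le_one (by linarith)]
  exact this.le

lemma isFiniteMeasure_atom (θ : ℝ) : IsFiniteMeasure (if 1 < |θ| then
    ENNReal.ofReal (1 - 1 / θ ^ 2) • Measure.dirac (θ + 1 / θ) else 0) := by
  split_ifs
  · exact Measure.smul_finite _ ENNReal.ofReal_ne_top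
  · infer_instance

lemma cauchyTransform_atom (θ : ℝ) {z : ℂ} (hz : 0 < z.im) :
    cauchyTransform (if 1 < |θ| then
      ENNReal.ofReal (1 - 1 / θ ^ 2) • Measure.dirac (θ + 1 / θ) else 0) z =
      θ * (1 - (if 1 < |θ| then ((θ : ℂ) ^ 2)⁻¹ else 1)) / (θ * z - (θ ^ 2 + 1)) := by
  split_ifs with h
  · have hθ : (θ : ℂ) ≠ 0 := by
      rintro h₀
      simp [ofReal_eq_zero.1 h₀] at h
      linarith
    have hD := theta_mul_sub_ne_zero θ hz
    have hfac : z - ((θ + 1 / θ : ℝ) : ℂ) = (θ * z - (θ ^ 2 + 1)) / θ := by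
      push_cast
      field_simp
    rw [cauchyTransform, integral_smul_measure, integral_dirac,
      ENNReal.toReal_ofReal (one_sub_one_div_sq_nonneg h), real_smul, hfac]
    push_cast
    field_simp
  · simp [cauchyTransform]

lemma cauchyTransform_add (μ ν : Measure ℝ) [IsFiniteMeasure μ] [IsFiniteMeasure ν] {z : ℂ}
    (hz : 0 < z.im) :
    cauchyTransform (μ + ν) z = cauchyTransform μ z + cauchyTransform ν z :=
  integral_add_measure (integrable_inv_sub_ofReal μ hz) (integrable_inv_sub_ofReal ν hz)

/-- The reciprocal Cauchy transform shifted by `θ`, as a Möbius image of `G_{μ_sc}`. -/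
lemma inv_recipCauchy_semicircle_sub (θ : ℝ) {z : ℂ} (hz : 0 < z.im) :
    (recipCauchy semicircle z - θ)⁻¹ =
      (θ - cauchyTransform semicircle z) / (θ * z - (θ ^ 2 + 1)) := by
  have hD := theta_mul_sub_ne_zero θ hz
  obtain ⟨w, hw₀, hw, rfl⟩ := exists_add_inv_eq hz
  rw [recipCauchy, cauchyTransform_semicircle_add_inv hw₀ hw]
  have hfac : θ * (w + w⁻¹) - ((θ : ℂ) ^ 2 + 1) = (w⁻¹ - θ) * (θ - w) := by
    field_simp
    ring
  rw [hfac] at hD ⊢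
  rw [div_mul_cancel_right₀ (right_ne_zero_of_mul hD)]

end

/-- The monotone convolution `δ_θ ▷ μ_sc` (characterized by
`G_{δ_θ ▷ μ_sc}(z) = 1/(F_{μ_sc}(z) − θ)` on `ℂ⁺`) equals the measure with density
`√(4 − x²)/(2π(θ² + 1 − θx))` on `|x| ≤ 2`, plus, when `|θ| > 1`, an atom of mass
`1 − 1/θ²` at `θ + 1/θ`. -/
theorem monotone_convolution_dirac_semicircle (θ : ℝ) (μ : Measure ℝ)
    [IsProbabilityMeasure μ]
    (hμ : ∀ z : ℂ, 0 < z.im →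
      cauchyTransform μ z = (recipCauchy semicircle z - (θ : ℂ))⁻¹) :
    μ = (volume.withDensity fun x =>
          ENNReal.ofReal (if |x| ≤ 2 then
            Real.sqrt (4 - x ^ 2) / (2 * π * (θ ^ 2 + 1 - θ * x)) else 0)) +
        (if 1 < |θ| then
          ENNReal.ofReal (1 - 1 / θ ^ 2) • Measure.dirac (θ + 1 / θ) else 0) := by
  have := isFiniteMeasure_atom θ
  rw [withDensity_eq_semicircle_withDensity]
  refine eq_of_cauchyTransform_eq fun z hz => ?_
  rw [hμ z hz, inv_recipCauchy_semicircle_sub θ hz, cauchyTransform_add _ _ hz,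
    cauchyTransform_semicircle_withDensity θ hz, cauchyTransform_atom θ hz]
  ring
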